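/- Let G be a concurrent game structure in which the may and must action sets coincide (Act^may = Act^must), the may and must transition functions coincide and are deterministic (each returns a singleton set of successors), and the labelling function assigns only the classical truth values ⊤ or ⊥ to every atom at every state. Then for every Strategy Logic formula φ in negation normal form, every assignment χ defined on the free agents and variables of φ, and every state s: the three-valued satisfaction value of φ at (G, χ, s) equals ⊥ if and only if (G, χ, s) does not satisfy φ under the two-valued semantics. -/

import Mathlib

/-! ## Three truth values and Łukasiewicz connectives -/

/-- The three truth values: true, false, undefined. -/
inductive TV : Type
  | tt | ff | uu
deriving DecidableEq

namespace TV

/-- Łukasiewicz negation. -/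
def neg : TV → TV
  | tt => ff
  | ff => tt
  | uu => uu

/-- Łukasiewicz conjunction. -/
def and : TV → TV → TV
  | tt, b => b
  | ff, _ => ff
  | uu, ff => ff
  | uu, _ => uu

/-- Łukasiewicz disjunction. -/
def or : TV → TV → TV
  | ff, b => b
  | tt, _ => tt
  | uu, tt => tt
  | uu, _ => uu

end TV

open Classical in
/-- Three-valued case distinction: `tt` if `T` holds, else `ff` if `F` holds, else `uu`. -/
noncomputable def tv3 (T F : Prop) : TV :=
  if T then .tt else if F then .ff else .uu

/-! ## Strategies, assignments, paths -/

/-- Strategies: functions from tracks (finite sequences of states) to actions. -/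
abbrev Strg (St Act : Type) := List St → Act

/-- Assignments map variables and agents to strategies. -/
abbrev Asg (Var Ag St Act : Type) := (Var ⊕ Ag) → Strg St Act

/-- A strategy is memoryless (positional) if its value only depends on the last state
of the track. -/
def Memoryless {St Act : Type} (f : Strg St Act) : Prop :=
  ∀ ρ ρ' : List St, ρ.getLast? = ρ'.getLast? → f ρ = f ρ'

/-- Prefix (up to and including position `i`) of an infinite path. -/
def pfx {St : Type} (π : ℕ → St) (i : ℕ) : List St := (List.range (i + 1)).map π

/-- Shift (translation) of a strategy along a track `ρ` (whose last state is the first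
state of the strategy's argument track). -/
def shiftStr {St Act : Type} (f : Strg St Act) (ρ : List St) : Strg St Act :=
  fun ρ' => f (ρ ++ ρ'.tail)

/-- The `i`-th global translation `χ_{π≤i}` of an assignment along a path. -/
def shiftAsg {Var Ag St Act : Type} (χ : Asg Var Ag St Act) (π : ℕ → St) (i : ℕ) :
    Asg Var Ag St Act :=
  fun l => shiftStr (χ l) (pfx π i)

/-! ## Strategy Logic syntax (negation normal form) -/

/-- Strategy Logic formulas in negation normal form: literals, `∧`, `∨`,
strategy quantifiers `∃x`, `∀x`, agent binding `(a,x)`, and temporal operators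
`X`, `U`, `R`. -/
inductive SLF (Ag Var AP : Type) : Type
  | atom : AP → SLF Ag Var AP
  | natom : AP → SLF Ag Var AP
  | and : SLF Ag Var AP → SLF Ag Var AP → SLF Ag Var AP
  | or : SLF Ag Var AP → SLF Ag Var AP → SLF Ag Var AP
  | ex : Var → SLF Ag Var AP → SLF Ag Var AP
  | all : Var → SLF Ag Var AP → SLF Ag Var AP
  | bind : Ag → Var → SLF Ag Var AP → SLF Ag Var AP
  | next : SLF Ag Var AP → SLF Ag Var AP
  | until_ : SLF Ag Var AP → SLF Ag Var AP → SLF Ag Var AP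
  | release : SLF Ag Var AP → SLF Ag Var AP → SLF Ag Var AP

/-- The set of free agents and variables of a formula. -/
def SLF.free {Ag Var AP : Type} : SLF Ag Var AP → Set (Var ⊕ Ag)
  | .atom _ => ∅
  | .natom _ => ∅
  | .and φ ψ => φ.free ∪ ψ.free
  | .or φ ψ => φ.free ∪ ψ.free
  | .ex x φ => φ.free \ {Sum.inl x}
  | .all x φ => φ.free \ {Sum.inl x}
  | .bind a x φ =>
      { l | (Sum.inr a ∈ φ.free ∧ (l ∈ φ.free \ {Sum.inr a} ∨ l = Sum.inl x)) ∨
            (Sum.inr a ∉ φ.free ∧ l ∈ φ.free) }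
  | .next φ => Set.range Sum.inr ∪ φ.free
  | .until_ φ ψ => Set.range Sum.inr ∪ φ.free ∪ ψ.free
  | .release φ ψ => Set.range Sum.inr ∪ φ.free ∪ ψ.free

/-- A sentence is a formula with no free agents or variables. -/
def SLF.Sentence {Ag Var AP : Type} (φ : SLF Ag Var AP) : Prop := φ.free = ∅

/-! ## Concurrent game structures and two-valued semantics -/

/-- A (two-valued) concurrent game structure with a deterministic transition function
(every action available to every agent at every state) and a two-valued labelling. -/
structure CGS (Ag St Act AP : Type) : Type where
  s0 : St
  tau : St → (Ag → Act) → St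
  V : St → AP → Bool

namespace CGS

variable {Ag St Act AP Var : Type}

/-- The prefix (of length `i+1`) of the unique play of a complete assignment from `t`. -/
def playPfx (G : CGS Ag St Act AP) (χ : Asg Var Ag St Act) (t : St) : ℕ → List St
  | 0 => [t]
  | i + 1 =>
      let l := playPfx G χ t i
      l ++ [G.tau (l.getLastD t) (fun a => χ (Sum.inr a) l)]

/-- The unique outcome play of a complete assignment from a state. -/
def play (G : CGS Ag St Act AP) (χ : Asg Var Ag St Act) (t : St) (i : ℕ) : St :=
  (G.playPfx χ t i).getLastD t

/-- The set of outcome plays of a complete assignment from a state (a singleton,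
since transitions are deterministic). -/
def plays (G : CGS Ag St Act AP) (χ : Asg Var Ag St Act) (t : St) : Set (ℕ → St) :=
  { π | π 0 = t ∧ ∀ i, π (i + 1) = G.tau (π i) (fun a => χ (Sum.inr a) (pfx π i)) }

variable [DecidableEq Var] [DecidableEq Ag]

/-- Two-valued satisfaction for Strategy Logic. -/
def sat2 (G : CGS Ag St Act AP) : SLF Ag Var AP → Asg Var Ag St Act → St → Prop
  | .atom p, _, s => G.V s p = true
  | .natom p, _, s => G.V s p = false
  | .and φ ψ, χ, s => sat2 G φ χ s ∧ sat2 G ψ χ s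
  | .or φ ψ, χ, s => sat2 G φ χ s ∨ sat2 G ψ χ s
  | .ex x φ, χ, s => ∃ f : Strg St Act, sat2 G φ (Function.update χ (Sum.inl x) f) s
  | .all x φ, χ, s => ∀ f : Strg St Act, sat2 G φ (Function.update χ (Sum.inl x) f) s
  | .bind a x φ, χ, s => sat2 G φ (Function.update χ (Sum.inr a) (χ (Sum.inl x))) s
  | .next φ, χ, s => sat2 G φ (shiftAsg χ (G.play χ s) 1) (G.play χ s 1)
  | .until_ φ ψ, χ, s => ∃ i : ℕ,
      sat2 G ψ (shiftAsg χ (G.play χ s) i) (G.play χ s i) ∧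
      ∀ j < i, sat2 G φ (shiftAsg χ (G.play χ s) j) (G.play χ s j)
  | .release φ ψ, χ, s => ∀ i : ℕ,
      sat2 G ψ (shiftAsg χ (G.play χ s) i) (G.play χ s i) ∨
      ∃ j ≤ i, sat2 G φ (shiftAsg χ (G.play χ s) j) (G.play χ s j)

/-- Two-valued satisfaction for Strategy Logic, memoryless variant: the clauses for
the strategy quantifiers are restricted to memoryless strategies. -/
def sat2m (G : CGS Ag St Act AP) : SLF Ag Var AP → Asg Var Ag St Act → St → Prop
  | .atom p, _, s => G.V s p = true
  | .natom p, _, s => G.V s p = false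
  | .and φ ψ, χ, s => sat2m G φ χ s ∧ sat2m G ψ χ s
  | .or φ ψ, χ, s => sat2m G φ χ s ∨ sat2m G ψ χ s
  | .ex x φ, χ, s => ∃ f : Strg St Act, Memoryless f ∧
      sat2m G φ (Function.update χ (Sum.inl x) f) s
  | .all x φ, χ, s => ∀ f : Strg St Act, Memoryless f →
      sat2m G φ (Function.update χ (Sum.inl x) f) s
  | .bind a x φ, χ, s => sat2m G φ (Function.update χ (Sum.inr a) (χ (Sum.inl x))) s
  | .next φ, χ, s => sat2m G φ (shiftAsg χ (G.play χ s) 1) (G.play χ s 1)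
  | .until_ φ ψ, χ, s => ∃ i : ℕ,
      sat2m G ψ (shiftAsg χ (G.play χ s) i) (G.play χ s i) ∧
      ∀ j < i, sat2m G φ (shiftAsg χ (G.play χ s) j) (G.play χ s j)
  | .release φ ψ, χ, s => ∀ i : ℕ,
      sat2m G ψ (shiftAsg χ (G.play χ s) i) (G.play χ s i) ∨
      ∃ j ≤ i, sat2m G φ (shiftAsg χ (G.play χ s) j) (G.play χ s j)

end CGS

/-! ## Three-valued concurrent game structures and three-valued semantics -/

/-- A three-valued concurrent game structure: may/must action sets with
`actMust ⊆ actMay`, possibly nondeterministic may/must transition functions with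
every must transition also a may transition, nonemptiness of successors on the
respective action profiles, and a three-valued labelling. -/
structure CGS3 (Ag St Act AP : Type) : Type where
  s0 : St
  actMay : Set Act
  actMust : Set Act
  tauMay : St → (Ag → Act) → Set St
  tauMust : St → (Ag → Act) → Set St
  V : St → AP → TV
  must_sub_may_act : actMust ⊆ actMay
  must_sub_may : ∀ s α, tauMust s α ⊆ tauMay s α
  may_nonempty : ∀ s α, (∀ a, α a ∈ actMay) → (tauMay s α).Nonempty
  must_nonempty : ∀ s α, (∀ a, α a ∈ actMust) → (tauMust s α).Nonempty

namespace CGS3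

variable {Ag St Act AP Var : Type}

/-- May-strategies: strategies mapping every track to a may action. -/
def StrMay (G : CGS3 Ag St Act AP) : Set (Strg St Act) := { f | ∀ ρ, f ρ ∈ G.actMay }

/-- Must-strategies: strategies mapping every track to a must action. -/
def StrMust (G : CGS3 Ag St Act AP) : Set (Strg St Act) := { f | ∀ ρ, f ρ ∈ G.actMust }

/-- The set `plays^may(χ,s)` of outcome paths of `χ` from `s` w.r.t. may transitions. -/
def playsMay (G : CGS3 Ag St Act AP) (χ : Asg Var Ag St Act) (s : St) : Set (ℕ → St) :=
  { π | π 0 = s ∧ ∀ i, π (i + 1) ∈ G.tauMay (π i) (fun a => χ (Sum.inr a) (pfx π i)) }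

/-- The set `plays^must(χ,s)` of outcome paths of `χ` from `s` w.r.t. must transitions. -/
def playsMust (G : CGS3 Ag St Act AP) (χ : Asg Var Ag St Act) (s : St) : Set (ℕ → St) :=
  { π | π 0 = s ∧ ∀ i, π (i + 1) ∈ G.tauMust (π i) (fun a => χ (Sum.inr a) (pfx π i)) }

variable [DecidableEq Var] [DecidableEq Ag]

/-- Three-valued satisfaction for Strategy Logic: Boolean connectives are
Łukasiewicz, `⊤` of existentials is witnessed by must-strategies and `⊥` refuted
over all may-strategies (universals dually), temporal operators are `⊤` over all
may-plays and `⊥` via some must-play; otherwise the value is `u`. -/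
noncomputable def sat3 (G : CGS3 Ag St Act AP) : SLF Ag Var AP → Asg Var Ag St Act → St → TV
  | .atom p, _, s => G.V s p
  | .natom p, _, s => (G.V s p).neg
  | .and φ ψ, χ, s => (sat3 G φ χ s).and (sat3 G ψ χ s)
  | .or φ ψ, χ, s => (sat3 G φ χ s).or (sat3 G ψ χ s)
  | .ex x φ, χ, s => tv3
      (∃ f ∈ StrMust G, sat3 G φ (Function.update χ (Sum.inl x) f) s = .tt)
      (∀ f ∈ StrMay G, sat3 G φ (Function.update χ (Sum.inl x) f) s = .ff)
  | .all x φ, χ, s => tv3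
      (∀ f ∈ StrMay G, sat3 G φ (Function.update χ (Sum.inl x) f) s = .tt)
      (∃ f ∈ StrMust G, sat3 G φ (Function.update χ (Sum.inl x) f) s = .ff)
  | .bind a x φ, χ, s => sat3 G φ (Function.update χ (Sum.inr a) (χ (Sum.inl x))) s
  | .next φ, χ, s => tv3
      (∀ π ∈ playsMay G χ s, sat3 G φ (shiftAsg χ π 1) (π 1) = .tt)
      (∃ π ∈ playsMust G χ s, sat3 G φ (shiftAsg χ π 1) (π 1) = .ff)
  | .until_ φ ψ, χ, s => tv3
      (∀ π ∈ playsMay G χ s, ∃ i : ℕ, sat3 G ψ (shiftAsg χ π i) (π i) = .tt ∧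
        ∀ j < i, sat3 G φ (shiftAsg χ π j) (π j) = .tt)
      (∃ π ∈ playsMust G χ s, ∀ i : ℕ, sat3 G ψ (shiftAsg χ π i) (π i) = .ff ∨
        ∃ j < i, sat3 G φ (shiftAsg χ π j) (π j) = .ff)
  | .release φ ψ, χ, s => tv3
      (∀ π ∈ playsMay G χ s, ∀ i : ℕ, sat3 G ψ (shiftAsg χ π i) (π i) = .tt ∨
        ∃ j ≤ i, sat3 G φ (shiftAsg χ π j) (π j) = .tt)
      (∃ π ∈ playsMust G χ s, ∃ i : ℕ, sat3 G ψ (shiftAsg χ π i) (π i) = .ff ∧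
        ∀ j ≤ i, sat3 G φ (shiftAsg χ π j) (π j) = .ff)

/-- Three-valued satisfaction, memoryless variant: the clauses for the strategy
quantifiers are restricted to memoryless (may/must) strategies. -/
noncomputable def sat3m (G : CGS3 Ag St Act AP) : SLF Ag Var AP → Asg Var Ag St Act → St → TV
  | .atom p, _, s => G.V s p
  | .natom p, _, s => (G.V s p).neg
  | .and φ ψ, χ, s => (sat3m G φ χ s).and (sat3m G ψ χ s)
  | .or φ ψ, χ, s => (sat3m G φ χ s).or (sat3m G ψ χ s)
  | .ex x φ, χ, s => tv3
      (∃ f ∈ StrMust G, Memoryless f ∧ sat3m G φ (Function.update χ (Sum.inl x) f) s = .tt)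
      (∀ f ∈ StrMay G, Memoryless f → sat3m G φ (Function.update χ (Sum.inl x) f) s = .ff)
  | .all x φ, χ, s => tv3
      (∀ f ∈ StrMay G, Memoryless f → sat3m G φ (Function.update χ (Sum.inl x) f) s = .tt)
      (∃ f ∈ StrMust G, Memoryless f ∧ sat3m G φ (Function.update χ (Sum.inl x) f) s = .ff)
  | .bind a x φ, χ, s => sat3m G φ (Function.update χ (Sum.inr a) (χ (Sum.inl x))) s
  | .next φ, χ, s => tv3
      (∀ π ∈ playsMay G χ s, sat3m G φ (shiftAsg χ π 1) (π 1) = .tt)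
      (∃ π ∈ playsMust G χ s, sat3m G φ (shiftAsg χ π 1) (π 1) = .ff)
  | .until_ φ ψ, χ, s => tv3
      (∀ π ∈ playsMay G χ s, ∃ i : ℕ, sat3m G ψ (shiftAsg χ π i) (π i) = .tt ∧
        ∀ j < i, sat3m G φ (shiftAsg χ π j) (π j) = .tt)
      (∃ π ∈ playsMust G χ s, ∀ i : ℕ, sat3m G ψ (shiftAsg χ π i) (π i) = .ff ∨
        ∃ j < i, sat3m G φ (shiftAsg χ π j) (π j) = .ff)
  | .release φ ψ, χ, s => tv3
      (∀ π ∈ playsMay G χ s, ∀ i : ℕ, sat3m G ψ (shiftAsg χ π i) (π i) = .tt ∨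
        ∃ j ≤ i, sat3m G φ (shiftAsg χ π j) (π j) = .tt)
      (∃ π ∈ playsMust G χ s, ∃ i : ℕ, sat3m G ψ (shiftAsg χ π i) (π i) = .ff ∧
        ∀ j ≤ i, sat3m G φ (shiftAsg χ π j) (π j) = .ff)

end CGS3

/-- A standard CGS regarded as a three-valued CGS: may and must action sets and
transition functions coincide, transitions are deterministic (singleton successor
sets), and the labelling takes only classical values. -/
def CGS.toCGS3 {Ag St Act AP : Type} (G : CGS Ag St Act AP) : CGS3 Ag St Act AP where
  s0 := G.s0
  actMay := Set.univ
  actMust := Set.univ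
  tauMay := fun s α => {G.tau s α}
  tauMust := fun s α => {G.tau s α}
  V := fun s p => if G.V s p then .tt else .ff
  must_sub_may_act := le_refl _
  must_sub_may := fun _ _ => le_refl _
  may_nonempty := fun s α _ => ⟨G.tau s α, rfl⟩
  must_nonempty := fun s α _ => ⟨G.tau s α, rfl⟩

/-! ## Three-valued abstraction of a CGS -/

section Abstraction

variable {Ag St Act AP Var : Type}

/-- May transitions of the abstraction: the existential lifting of `τ`,
`τ^may([s],α) = {[s'] | ∃ s″∈[s], ∃ s‴∈[s'], s‴ ∈ τ(s″,α)}`. -/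
def tauMayA (G : CGS Ag St Act AP) (r : Setoid St) :
    Quotient r → (Ag → Act) → Set (Quotient r) :=
  fun q α => { q' | ∃ t, Quotient.mk r t = q ∧ ∃ t', Quotient.mk r t' = q' ∧ t' = G.tau t α }

/-- Must transitions of the abstraction: the universal lifting of `τ`,
`τ^must([s],α) = {[s'] | ∀ s″∈[s], ∃ s‴∈[s'], s‴ ∈ τ(s″,α)}`. -/
def tauMustA (G : CGS Ag St Act AP) (r : Setoid St) :
    Quotient r → (Ag → Act) → Set (Quotient r) :=
  fun q α => { q' | ∀ t, Quotient.mk r t = q → ∃ t', Quotient.mk r t' = q' ∧ t' = G.tau t α }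

/-- Abstract three-valued labelling: `⊤` (resp. `⊥`) at a class iff the atom is
true (resp. false) at all its members, `u` otherwise. -/
noncomputable def VA (G : CGS Ag St Act AP) (r : Setoid St) : Quotient r → AP → TV :=
  fun q p => tv3 (∀ t, Quotient.mk r t = q → G.V t p = true)
                 (∀ t, Quotient.mk r t = q → G.V t p = false)

/-- `A` is a set of must actions: the must transition function returns a nonempty
successor set on every abstract state and every action profile over `A`. -/
def GoodMustActs (G : CGS Ag St Act AP) (r : Setoid St) (A : Set Act) : Prop :=
  ∀ (q : Quotient r) (α : Ag → Act), (∀ a, α a ∈ A) → (tauMustA G r q α).Nonempty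

/-- `A` is a maximal (w.r.t. set inclusion) set of must actions. -/
def IsMaxMustActs (G : CGS Ag St Act AP) (r : Setoid St) (A : Set Act) : Prop :=
  GoodMustActs G r A ∧ ∀ B : Set Act, A ⊆ B → GoodMustActs G r B → B = A

/-- The abstract model `A(G)` of a CGS `G` w.r.t. an equivalence relation `≈` on
states (and a chosen must action set): states are the equivalence classes, may
actions are all of `Act`, may/must transitions are the existential/universal
liftings of `τ`, and the labelling is the three-valued abstraction of `V`. -/
noncomputable def abstractCGS (G : CGS Ag St Act AP) (r : Setoid St) (Amust : Set Act)
    (h : GoodMustActs G r Amust) : CGS3 Ag (Quotient r) Act AP where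
  s0 := Quotient.mk r G.s0
  actMay := Set.univ
  actMust := Amust
  tauMay := tauMayA G r
  tauMust := tauMustA G r
  V := VA G r
  must_sub_may_act := Set.subset_univ _
  must_sub_may := by
    intro q α q' hq'
    obtain ⟨t, ht⟩ := Quotient.exists_rep q
    exact ⟨t, ht, hq' t ht⟩
  may_nonempty := by
    intro q α _
    obtain ⟨t, ht⟩ := Quotient.exists_rep q
    exact ⟨Quotient.mk r (G.tau t α), t, ht, G.tau t α, rfl, rfl⟩
  must_nonempty := h

/-- The set of concrete strategies corresponding to an abstract strategy:
`concr(f) = { f* | f*(s0,…,sn) = f([s0],…,[sn]) }`. -/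
def concrStr (r : Setoid St) (f : Strg (Quotient r) Act) : Set (Strg St Act) :=
  { g | ∀ l : List St, g l = f (l.map (Quotient.mk r)) }

/-- `concr` lifted pointwise to assignments. -/
def concrAsg (r : Setoid St) (χ : Asg Var Ag (Quotient r) Act) :
    Set (Asg Var Ag St Act) :=
  { χ' | ∀ l, χ' l ∈ concrStr r (χ l) }

/-- `concr` lifted to sets of strategies. -/
def concrSet (r : Setoid St) (F : Set (Strg (Quotient r) Act)) : Set (Strg St Act) :=
  { g | ∃ f ∈ F, g ∈ concrStr r f }

/-- The set of may-strategies of the abstraction corresponding to a concrete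
strategy: `abstr^may(f) = { f† | f†([s0],…,[sn]) = f(s0',…,sn') for some
representatives s0'∈[s0], …, sn'∈[sn] }`. -/
def abstrMayStr (r : Setoid St) (f : Strg St Act) : Set (Strg (Quotient r) Act) :=
  { f' | ∀ L : List (Quotient r), ∃ l : List St, l.map (Quotient.mk r) = L ∧ f' L = f l }

/-- The set of must-strategies of the abstraction corresponding to a concrete
strategy: `abstr^must(f) = abstr^may(f) ∩ Str^must`. -/
def abstrMustStr (r : Setoid St) (Amust : Set Act) (f : Strg St Act) :
    Set (Strg (Quotient r) Act) :=
  abstrMayStr r f ∩ { f' | ∀ L, f' L ∈ Amust }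

/-- `abstr^must` lifted to sets of strategies. -/
def abstrMustSet (r : Setoid St) (Amust : Set Act) (F : Set (Strg St Act)) :
    Set (Strg (Quotient r) Act) :=
  { f' | ∃ f ∈ F, f' ∈ abstrMustStr r Amust f }

end Abstraction

theorem tv3_not_eq_tt {P : Prop} : tv3 P (¬ P) = TV.tt ↔ P := by
  by_cases h : P <;> simp [tv3, h]

theorem tv3_not_eq_ff {P : Prop} : tv3 P (¬ P) = TV.ff ↔ ¬ P := by
  by_cases h : P <;> simp [tv3, h]

theorem tv3_not_and {P Q : Prop} :
    (tv3 P (¬ P)).and (tv3 Q (¬ Q)) = tv3 (P ∧ Q) (¬ (P ∧ Q)) := by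
  by_cases hP : P <;> by_cases hQ : Q <;> simp [tv3, hP, hQ, TV.and]

theorem tv3_not_or {P Q : Prop} :
    (tv3 P (¬ P)).or (tv3 Q (¬ Q)) = tv3 (P ∨ Q) (¬ (P ∨ Q)) := by
  by_cases hP : P <;> by_cases hQ : Q <;> simp [tv3, hP, hQ, TV.or]

theorem pfx_succ {St : Type} (π : ℕ → St) (i : ℕ) :
    pfx π (i + 1) = pfx π i ++ [π (i + 1)] := by
  simp [pfx, List.range_succ]

namespace CGS

variable {Ag St Act AP Var : Type}

theorem pfx_play (G : CGS Ag St Act AP) (χ : Asg Var Ag St Act) (s : St) (i : ℕ) :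
    pfx (G.play χ s) i = G.playPfx χ s i := by
  induction i with
  | zero => simp [pfx, play, playPfx]
  | succ i ih => rw [pfx_succ, ih]; simp [play, playPfx]

theorem play_succ (G : CGS Ag St Act AP) (χ : Asg Var Ag St Act) (s : St) (i : ℕ) :
    G.play χ s (i + 1) =
      G.tau (G.play χ s i) (fun a => χ (Sum.inr a) (pfx (G.play χ s) i)) := by
  rw [pfx_play]
  simp [play, playPfx]

theorem plays_eq_singleton (G : CGS Ag St Act AP) (χ : Asg Var Ag St Act) (s : St) :
    G.plays χ s = {G.play χ s} := by
  ext π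
  simp only [Set.mem_singleton_iff]
  constructor
  · rintro ⟨h0, hs⟩
    funext i
    induction i using Nat.strong_induction_on with
    | _ i ih =>
      cases i with
      | zero => simp [h0, play, playPfx]
      | succ i =>
        have hp : pfx π i = pfx (G.play χ s) i := by
          refine List.map_congr_left fun j hj => ih j ?_
          simpa using hj
        rw [hs, play_succ, hp, ih i (Nat.lt_succ_self i)]
  · rintro rfl
    exact ⟨by simp [play, playPfx], G.play_succ χ s⟩

theorem playsMay_toCGS3 (G : CGS Ag St Act AP) (χ : Asg Var Ag St Act) (s : St) :
    CGS3.playsMay G.toCGS3 χ s = {G.play χ s} :=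
  G.plays_eq_singleton χ s

theorem playsMust_toCGS3 (G : CGS Ag St Act AP) (χ : Asg Var Ag St Act) (s : St) :
    CGS3.playsMust G.toCGS3 χ s = {G.play χ s} :=
  G.plays_eq_singleton χ s

theorem strMay_toCGS3 (G : CGS Ag St Act AP) : CGS3.StrMay G.toCGS3 = Set.univ :=
  Set.eq_univ_of_forall fun _ _ => Set.mem_univ _

theorem strMust_toCGS3 (G : CGS Ag St Act AP) : CGS3.StrMust G.toCGS3 = Set.univ :=
  Set.eq_univ_of_forall fun _ _ => Set.mem_univ _

/-- On a standard CGS the three-valued semantics never takes the value `u`, and agrees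
with the two-valued semantics. -/
theorem sat3_toCGS3 [DecidableEq Var] [DecidableEq Ag] (G : CGS Ag St Act AP)
    (φ : SLF Ag Var AP) (χ : Asg Var Ag St Act) (s : St) :
    CGS3.sat3 G.toCGS3 φ χ s = tv3 (G.sat2 φ χ s) (¬ G.sat2 φ χ s) := by
  induction φ generalizing χ s with
  | atom p => cases h : G.V s p <;> simp [CGS3.sat3, sat2, toCGS3, tv3, h]
  | natom p => cases h : G.V s p <;> simp [CGS3.sat3, sat2, toCGS3, tv3, h, TV.neg]
  | and φ ψ ihφ ihψ => simp only [CGS3.sat3, sat2, ihφ, ihψ, tv3_not_and]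
  | or φ ψ ihφ ihψ => simp only [CGS3.sat3, sat2, ihφ, ihψ, tv3_not_or]
  | ex x φ ih =>
    simp [CGS3.sat3, sat2, ih, tv3_not_eq_tt, tv3_not_eq_ff, strMay_toCGS3, strMust_toCGS3]
  | all x φ ih =>
    simp [CGS3.sat3, sat2, ih, tv3_not_eq_tt, tv3_not_eq_ff, strMay_toCGS3, strMust_toCGS3]
  | bind a x φ ih => simp only [CGS3.sat3, sat2, ih]
  | next φ ih =>
    simp [CGS3.sat3, sat2, ih, tv3_not_eq_tt, tv3_not_eq_ff, playsMay_toCGS3,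
      playsMust_toCGS3]
  | until_ φ ψ ihφ ihψ =>
    simp [CGS3.sat3, sat2, ihφ, ihψ, tv3_not_eq_tt, tv3_not_eq_ff, playsMay_toCGS3,
      playsMust_toCGS3, -not_and, not_and_or]
  | release φ ψ ihφ ihψ =>
    simp [CGS3.sat3, sat2, ihφ, ihψ, tv3_not_eq_tt, tv3_not_eq_ff, playsMay_toCGS3,
      playsMust_toCGS3]

end CGS


/-- **Conservativeness (⊥ direction)**: on a standard CGS (may = must actions,
coinciding deterministic transitions, classical labelling), the three-valued
satisfaction value of an SL formula equals `⊥` iff the formula fails two-valuedly. -/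
theorem conservativeness_false {Ag St Act AP Var : Type}
    [Fintype Ag] [Nonempty Ag] [Fintype St] [Nonempty St] [Fintype Act] [Nonempty Act]
    [DecidableEq Ag] [DecidableEq Var]
    (G : CGS Ag St Act AP) (φ : SLF Ag Var AP) (χ : Asg Var Ag St Act) (s : St) :
    CGS3.sat3 G.toCGS3 φ χ s = TV.ff ↔ ¬ CGS.sat2 G φ χ s := by
  rw [G.sat3_toCGS3, tv3_not_eq_ff]
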